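/- Let M ∈ ℝ^{n×n} be a symmetric matrix. Then F(Y) = (1/2)‖M − Y‖² has a gradient that is Lipschitz continuous with constant 1, and the SymNMF objective f(X) = (1/2)‖M − XXᵀ‖² on ℝ^{n×r} is 1-smooth relative to the universal kernel h_u(X) = (α/4)‖X‖⁴ + (σ/2)‖X‖² with α = 6 and σ = 2‖M‖, i.e., f(X) ≤ f(Y) + ⟨∇f(Y), X − Y⟩ + D_{h_u}(X, Y) for all X, Y ∈ ℝ^{n×r}. -/

import Mathlib

open Matrix

attribute [local instance] Matrix.frobeniusNormedAddCommGroup Matrix.frobeniusNormedSpace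

/-- Frobenius inner product `⟨X, Y⟩ = Tr(Xᵀ Y)`. -/
noncomputable def minner {n r : ℕ} (X Y : Matrix (Fin n) (Fin r) ℝ) : ℝ := (Xᵀ * Y).trace

/-- The continuous linear functional `U ↦ ⟨W, U⟩` (Frobenius inner product with `W`). -/
noncomputable def innerCLM {n r : ℕ} (W : Matrix (Fin n) (Fin r) ℝ) :
    Matrix (Fin n) (Fin r) ℝ →L[ℝ] ℝ :=
  LinearMap.toContinuousLinearMap
    { toFun := fun U => minner W U
      map_add' := by intro U V; simp [minner, Matrix.mul_add]
      map_smul' := by intro c U; simp [minner, Matrix.mul_smul] }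

/-- The universal kernel `h_u(X) = (α/4)‖X‖⁴ + (σ/2)‖X‖²` (Frobenius norm). -/
noncomputable def hu {n r : ℕ} (α σ : ℝ) (X : Matrix (Fin n) (Fin r) ℝ) : ℝ :=
  α / 4 * ‖X‖ ^ 4 + σ / 2 * ‖X‖ ^ 2

lemma mi_norm {n r : ℕ} (X : Matrix (Fin n) (Fin r) ℝ) : ‖X‖ ^ 2 = minner X X := by
  rw [Matrix.frobenius_norm_def, ← Real.sqrt_eq_rpow, Real.sq_sqrt (by positivity)]
  simp only [minner, Matrix.trace, Matrix.diag, Matrix.mul_apply, Matrix.transpose_apply]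
  rw [Finset.sum_comm]
  simp [sq]

lemma mi_add_left {n r : ℕ} (X Y Z : Matrix (Fin n) (Fin r) ℝ) :
    minner (X + Y) Z = minner X Z + minner Y Z := by
  simp [minner, Matrix.add_mul]

lemma mi_smul_left {n r : ℕ} (c : ℝ) (X Z : Matrix (Fin n) (Fin r) ℝ) :
    minner (c • X) Z = c * minner X Z := by
  simp [minner]

lemma mi_sub_left {n r : ℕ} (X Y Z : Matrix (Fin n) (Fin r) ℝ) :
    minner (X - Y) Z = minner X Z - minner Y Z := by
  simp [minner, Matrix.sub_mul]

lemma mi_comm {n r : ℕ} (X Y : Matrix (Fin n) (Fin r) ℝ) : minner X Y = minner Y X := by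
  unfold minner
  rw [← Matrix.trace_transpose]
  simp

lemma mi_add_right {n r : ℕ} (X Y Z : Matrix (Fin n) (Fin r) ℝ) :
    minner Z (X + Y) = minner Z X + minner Z Y := by
  simp [minner, Matrix.mul_add]

lemma mi_smul_right {n r : ℕ} (c : ℝ) (X Z : Matrix (Fin n) (Fin r) ℝ) :
    minner Z (c • X) = c * minner Z X := by
  simp [minner]

lemma mi_sub_right {n r : ℕ} (X Y Z : Matrix (Fin n) (Fin r) ℝ) :
    minner Z (X - Y) = minner Z X - minner Z Y := by
  simp [minner, Matrix.mul_sub]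

lemma mi_cs {n r : ℕ} (X Y : Matrix (Fin n) (Fin r) ℝ) : minner X Y ≤ ‖X‖ * ‖Y‖ := by
  have hs : ‖X + Y‖ ≤ ‖X‖ + ‖Y‖ := norm_add_le X Y
  have h2 := pow_le_pow_left₀ (norm_nonneg (X + Y)) hs 2
  have hx := mi_norm X
  have hy := mi_norm Y
  rw [mi_norm, mi_add_left, mi_add_right, mi_add_right, mi_comm Y X] at h2
  nlinarith

lemma norm_tr {n r : ℕ} (X : Matrix (Fin n) (Fin r) ℝ) : ‖Xᵀ‖ = ‖X‖ :=
  Matrix.frobenius_norm_transpose X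

lemma hess {n r : ℕ} (M : Matrix (Fin n) (Fin n) ℝ) (Z H : Matrix (Fin n) (Fin r) ℝ) :
    2 * minner (Z * Zᵀ) (H * Hᵀ) - 2 * minner M (H * Hᵀ)
      + minner (Z * Hᵀ + H * Zᵀ) (Z * Hᵀ + H * Zᵀ)
      ≤ 6 * (minner Z Z * minner H H) + 2 * ‖M‖ * minner H H := by
  have hB : ‖H * Hᵀ‖ ≤ ‖H‖ * ‖H‖ := by
    have := Matrix.frobenius_norm_mul H Hᵀ
    rwa [norm_tr] at this
  have hP : ‖Z * Zᵀ‖ ≤ ‖Z‖ * ‖Z‖ := by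
    have := Matrix.frobenius_norm_mul Z Zᵀ
    rwa [norm_tr] at this
  have h1 : ‖Z * Hᵀ‖ ≤ ‖Z‖ * ‖H‖ := by
    have := Matrix.frobenius_norm_mul Z Hᵀ
    rwa [norm_tr] at this
  have h2 : ‖H * Zᵀ‖ ≤ ‖H‖ * ‖Z‖ := by
    have := Matrix.frobenius_norm_mul H Zᵀ
    rwa [norm_tr] at this
  have hA : ‖Z * Hᵀ + H * Zᵀ‖ ≤ 2 * (‖Z‖ * ‖H‖) := by
    have := norm_add_le (Z * Hᵀ) (H * Zᵀ)
    linarith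
  have hA2 := pow_le_pow_left₀ (norm_nonneg _) hA 2
  have c1 : minner (Z * Zᵀ) (H * Hᵀ) ≤ (‖Z‖ * ‖Z‖) * (‖H‖ * ‖H‖) :=
    (mi_cs _ _).trans (mul_le_mul hP hB (norm_nonneg _) (by positivity))
  have c2 : -minner M (H * Hᵀ) ≤ ‖M‖ * (‖H‖ * ‖H‖) := by
    have h := mi_cs (-M) (H * Hᵀ)
    have e : minner (-M) (H * Hᵀ) = -minner M (H * Hᵀ) := by simp [minner]
    rw [e, norm_neg] at h
    exact h.trans (mul_le_mul_of_nonneg_left hB (norm_nonneg _))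
  rw [← mi_norm, ← mi_norm, ← mi_norm]
  nlinarith

lemma expand {n r : ℕ} (M : Matrix (Fin n) (Fin n) ℝ) (Y H : Matrix (Fin n) (Fin r) ℝ) (t : ℝ) :
    M - (Y + t • H) * (Y + t • H)ᵀ
      = (M - Y * Yᵀ) - t • (Y * Hᵀ + H * Yᵀ) - t ^ 2 • (H * Hᵀ) := by
  simp only [Matrix.transpose_add, Matrix.transpose_smul, Matrix.add_mul, Matrix.mul_add,
    Matrix.smul_mul, Matrix.mul_smul, smul_add, smul_smul]
  rw [sq]
  abel

lemma grad {n r : ℕ} (M : Matrix (Fin n) (Fin n) ℝ)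
    (f : Matrix (Fin n) (Fin r) ℝ → ℝ)
    (hfdef : ∀ X, f X = 1 / 2 * ‖M - X * Xᵀ‖ ^ 2)
    (G Y H : Matrix (Fin n) (Fin r) ℝ)
    (hg : HasFDerivAt f (innerCLM G) Y) :
    minner G H = - minner (M - Y * Yᵀ) (Y * Hᵀ + H * Yᵀ) := by
  have hl : HasDerivAt (fun t : ℝ => Y + t • H) H 0 := by
    have := ((hasDerivAt_id (0 : ℝ)).smul_const H).const_add Y
    rw [one_smul] at this
    exact this
  have h0 : Y + (0 : ℝ) • H = Y := by simp
  have hc : HasDerivAt (fun t : ℝ => f (Y + t • H)) (minner G H) 0 := by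
    have hg' : HasFDerivAt f (innerCLM G) (Y + (0 : ℝ) • H) := by rw [h0]; exact hg
    exact hg'.comp_hasDerivAt (0 : ℝ) hl
  set R := M - Y * Yᵀ with hR
  set A := Y * Hᵀ + H * Yᵀ with hA
  set B := H * Hᵀ with hB
  have he : (fun t : ℝ => f (Y + t • H)) = fun t : ℝ =>
      1 / 2 * minner R R + t * (-minner R A) + t ^ 2 * (1 / 2 * minner A A - minner R B)
        + t ^ 3 * minner A B + t ^ 4 * (1 / 2 * minner B B) := by
    funext t
    rw [hfdef, expand, mi_norm]
    simp only [← hR, ← hA, ← hB, mi_sub_left, mi_sub_right, mi_smul_left, mi_smul_right]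
    rw [mi_comm A R, mi_comm B R, mi_comm B A]
    ring
  rw [he] at hc
  have hd : HasDerivAt (fun t : ℝ =>
      1 / 2 * minner R R + t * (-minner R A) + t ^ 2 * (1 / 2 * minner A A - minner R B)
        + t ^ 3 * minner A B + t ^ 4 * (1 / 2 * minner B B)) (-minner R A) 0 := by
    have a1 := (hasDerivAt_id (0 : ℝ)).mul_const (-minner R A)
    have a2 := (hasDerivAt_pow 2 (0 : ℝ)).mul_const (1 / 2 * minner A A - minner R B)
    have a3 := (hasDerivAt_pow 3 (0 : ℝ)).mul_const (minner A B)
    have a4 := (hasDerivAt_pow 4 (0 : ℝ)).mul_const (1 / 2 * minner B B)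
    have := (((a1.const_add (1 / 2 * minner R R)).add a2).add a3).add a4
    exact this.congr_deriv (by simp)
  exact hc.unique hd

/-- SymNMF relative smoothness.  For symmetric `M`, the function
`F(Y) = ½‖M − Y‖²` has gradient `∇F(Y) = Y − M`, which is Lipschitz with constant `1`, and
`f(X) = ½‖M − XXᵀ‖²` (with gradient `f'`) is `1`-smooth relative to the universal kernel
`h_u` with `α = 6` and `σ = 2‖M‖`. -/
theorem symnmf_relative_smoothness {n r : ℕ} (M : Matrix (Fin n) (Fin n) ℝ)
    (hM : M.IsSymm)
    (f : Matrix (Fin n) (Fin r) ℝ → ℝ)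
    (hfdef : ∀ X, f X = 1 / 2 * ‖M - X * Xᵀ‖ ^ 2)
    (f' : Matrix (Fin n) (Fin r) ℝ → Matrix (Fin n) (Fin r) ℝ)
    (hfgrad : ∀ X, HasFDerivAt f (innerCLM (f' X)) X) :
    (∀ Y : Matrix (Fin n) (Fin n) ℝ,
      HasFDerivAt (fun Y : Matrix (Fin n) (Fin n) ℝ => 1 / 2 * ‖M - Y‖ ^ 2)
        (innerCLM (Y - M)) Y) ∧
    (∀ Y₁ Y₂ : Matrix (Fin n) (Fin n) ℝ, ‖(Y₁ - M) - (Y₂ - M)‖ ≤ 1 * ‖Y₁ - Y₂‖) ∧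
    (∀ X Y : Matrix (Fin n) (Fin r) ℝ,
      f X ≤ f Y + minner (f' Y) (X - Y) +
        (hu 6 (2 * ‖M‖) X - hu 6 (2 * ‖M‖) Y -
          minner ((6 * ‖Y‖ ^ 2 + 2 * ‖M‖) • Y) (X - Y))) := by
  refine ⟨?_, ?_, ?_⟩
  · intro Y
    refine hasFDerivAt_iff_isLittleO_nhds_zero.2 ?_
    have h1 : (fun h : Matrix (Fin n) (Fin n) ℝ => (1 / 2 : ℝ) * ‖h‖ ^ 2) =o[nhds 0]
        fun h => h :=
      (Asymptotics.isLittleO_norm_pow_id one_lt_two).const_mul_left _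
    refine h1.congr_left ?_
    intro h
    change (1 / 2 : ℝ) * ‖h‖ ^ 2 = 1 / 2 * ‖M - (Y + h)‖ ^ 2 - 1 / 2 * ‖M - Y‖ ^ 2 -
      minner (Y - M) h
    rw [mi_norm, mi_norm, mi_norm]
    simp only [mi_sub_left, mi_sub_right, mi_add_left, mi_add_right]
    rw [mi_comm Y M, mi_comm h M, mi_comm h Y]
    ring
  · intro Y₁ Y₂
    rw [one_mul, sub_sub_sub_cancel_right]
  · intro X Y
    obtain ⟨H, rfl⟩ : ∃ H, X = Y + H := ⟨X - Y, by abel⟩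
    rw [add_sub_cancel_left, grad M f hfdef (f' Y) Y H (hfgrad Y), hfdef, hfdef]
    have ex := expand M Y H 1
    rw [one_smul, one_smul, one_pow, one_smul] at ex
    have q1 := hess M Y H
    have q2 := hess M (Y + (1 / 2 : ℝ) • H) H
    have eA : (Y + (1 / 2 : ℝ) • H) * Hᵀ + H * (Y + (1 / 2 : ℝ) • H)ᵀ
        = (Y * Hᵀ + H * Yᵀ) + H * Hᵀ := by
      simp only [Matrix.transpose_add, Matrix.transpose_smul, Matrix.add_mul, Matrix.mul_add,
        Matrix.smul_mul, Matrix.mul_smul]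
      module
    have eP : (Y + (1 / 2 : ℝ) • H) * (Y + (1 / 2 : ℝ) • H)ᵀ
        = Y * Yᵀ + (1 / 2 : ℝ) • (Y * Hᵀ + H * Yᵀ) + (1 / 4 : ℝ) • (H * Hᵀ) := by
      simp only [Matrix.transpose_add, Matrix.transpose_smul, Matrix.add_mul, Matrix.mul_add,
        Matrix.smul_mul, Matrix.mul_smul]
      module
    rw [eA, eP] at q2
    have p4 : ∀ Z : Matrix (Fin n) (Fin r) ℝ, ‖Z‖ ^ 4 = minner Z Z ^ 2 := by
      intro Z
      rw [← mi_norm]; ring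
    rw [ex]
    unfold hu
    rw [p4, p4]
    simp only [mi_norm (M - Y * Yᵀ), mi_norm (M - Y * Yᵀ - (Y * Hᵀ + H * Yᵀ) - H * Hᵀ), mi_norm Y,
      mi_norm (Y + H)]
    generalize Y * Hᵀ + H * Yᵀ = A at *
    generalize H * Hᵀ = B at *
    generalize Y * Yᵀ = P at *
    simp only [mi_sub_left, mi_sub_right, mi_add_left, mi_add_right, mi_smul_left,
      mi_smul_right] at q1 q2 ⊢
    rw [mi_comm H Y] at *
    rw [mi_comm B A] at *
    simp only [mi_comm B P, mi_comm B M, mi_comm A P, mi_comm A M, mi_comm P M] at *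
    generalize minner Y H = s at *
    generalize minner H H = t at *
    generalize minner Y Y = y at *
    nlinarith [sq_nonneg (2 * s + t), sq_nonneg s]
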